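/- arXiv:1111.3480 — 2 statements merged into one kernel-verified Lean document; each statement's English description precedes it below -/
import Mathlib

section
/- Let G be a finite graph on n vertices and let k ≥ 2 be an integer such that every vertex u of G satisfies |N_k(u)| > n/2 − 1 (equivalently, 2|N_k(u)| > n − 2). Then G admits an orientation of radius at most 4k² and an orientation of diameter at most 8k². -/
open SimpleGraph Finset

variable {V : Type*}

/-- `o` is an orientation of `G`: each edge of `G` gets exactly one direction. -/
def IsOrientation (G : SimpleGraph V) (o : V → V → Prop) : Prop :=
  (∀ x y, o x y → G.Adj x y) ∧ (∀ x y, G.Adj x y → (o x y ∨ o y x)) ∧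
    (∀ x y, o x y → ¬ o y x)

/-- There is a directed path (with respect to `o`) from `x` to `y` of length at most `n`. -/
def DPathLE (o : V → V → Prop) (n : ℕ) (x y : V) : Prop :=
  ∃ m ≤ n, ∃ f : ℕ → V, f 0 = x ∧ f m = y ∧ (∀ i < m, o (f i) (f (i + 1))) ∧
    (∀ i ≤ m, ∀ j ≤ m, f i = f j → i = j)

/-- `G` admits an orientation of radius at most `R`. -/
def OrientRadiusLE (G : SimpleGraph V) (R : ℕ) : Prop :=
  ∃ o : V → V → Prop, IsOrientation G o ∧
    ∃ u : V, ∀ v : V, DPathLE o R u v ∧ DPathLE o R v u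

/-- `G` admits an orientation of diameter at most `D`. -/
def OrientDiamLE (G : SimpleGraph V) (D : ℕ) : Prop :=
  ∃ o : V → V → Prop, IsOrientation G o ∧ ∀ x y : V, DPathLE o D x y

/-- The edge `e` lies on a cycle of `G` of length at most `n`. -/
def InCycleLE (G : SimpleGraph V) (e : Sym2 V) (n : ℕ) : Prop :=
  ∃ (v : V) (c : G.Walk v v), c.IsCycle ∧ e ∈ c.edges ∧ c.length ≤ n

/-- `G` is bridgeless: no edge is a cut edge. -/
def Bridgeless (G : SimpleGraph V) : Prop :=
  ∀ e ∈ G.edgeSet, ¬ G.IsBridge e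

/-- `c` is a rainbow `k`-edge-coloring of `G`: every two distinct vertices are joined
by a path whose edges receive pairwise distinct colors. -/
def IsRainbowColoring (G : SimpleGraph V) (k : ℕ) (c : Sym2 V → Fin k) : Prop :=
  ∀ x y : V, x ≠ y → ∃ p : G.Walk x y, p.IsPath ∧ (p.edges.map c).Nodup

/-- The rainbow connection number of `G` is at most `k`. -/
def RcLE (G : SimpleGraph V) (k : ℕ) : Prop :=
  ∃ c : Sym2 V → Fin k, IsRainbowColoring G k c

/-- Directed walk of length at most `n`. -/
inductive DW (o : V → V → Prop) : ℕ → V → V → Prop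
  | refl (n : ℕ) (x : V) : DW o n x x
  | step {n : ℕ} {x y z : V} : o x y → DW o n y z → DW o (n + 1) x z

theorem DW.mono {o o' : V → V → Prop} (h : ∀ x y, o x y → o' x y) {n : ℕ} {x y : V}
    (w : DW o n x y) : ∀ m, n ≤ m → DW o' m x y := by
  induction w with
  | refl n x => intro m _; exact DW.refl m x
  | step hxy _ ih =>
    intro m hm
    obtain ⟨m', rfl⟩ : ∃ m', m = m' + 1 := ⟨m - 1, by omega⟩
    exact DW.step (h _ _ hxy) (ih m' (by omega))

theorem DW.trans {o : V → V → Prop} {n : ℕ} {x y : V} (w : DW o n x y) :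
    ∀ {m : ℕ} {z : V}, DW o m y z → DW o (n + m) x z := by
  induction w with
  | refl n x => intro m z h; exact h.mono (fun _ _ h => h) _ (by omega)
  | step hxy _ ih =>
    intro m z h
    exact (DW.step hxy (ih h)).mono (fun _ _ h => h) _ (by omega)

theorem DW.flip {o : V → V → Prop} {n : ℕ} {x y : V} (w : DW o n x y) :
    DW (fun a b => o b a) n y x := by
  induction w with
  | refl n x => exact DW.refl n x
  | @step n x y z hxy _ ih =>
    exact ih.trans (DW.step (o := fun a b => o b a) (n := 0) hxy (DW.refl 0 x))

theorem DW.toPath {o : V → V → Prop} {n : ℕ} {x y : V} (w : DW o n x y) : DPathLE o n x y := by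
  induction w with
  | refl n x =>
    refine ⟨0, by omega, fun _ => x, rfl, rfl, by intro i hi; omega, ?_⟩
    intro i hi j hj _; omega
  | @step n x y z hxy _ ih =>
    obtain ⟨m, hm, f, h0, h1, h2, h3⟩ := ih
    by_cases hx : ∃ i ≤ m, f i = x
    · obtain ⟨i, hi, hix⟩ := hx
      refine ⟨m - i, by omega, fun j => f (i + j), by simpa using hix, ?_, ?_, ?_⟩
      · show f (i + (m - i)) = z
        rw [show i + (m - i) = m by omega, h1]
      · intro j hj; exact h2 (i + j) (by omega)
      · intro a ha b hb hab
        have := h3 (i + a) (by omega) (i + b) (by omega) hab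
        omega
    · push Not at hx
      refine ⟨m + 1, by omega, fun j => Nat.casesOn j x f, rfl, h1, ?_, ?_⟩
      · intro i hi
        cases i with
        | zero => simpa [h0] using hxy
        | succ i => exact h2 i (by omega)
      · intro a ha b hb hab
        cases a with
        | zero =>
          cases b with
          | zero => rfl
          | succ b => exact absurd hab.symm (hx b (by omega))
        | succ a =>
          cases b with
          | zero => exact absurd hab (hx a (by omega))
          | succ b =>
            have := h3 a (by omega) b (by omega) hab
            omega

/-- A partial orientation supported on `H`. -/
def POr (G : SimpleGraph V) (H : Set V) (o : V → V → Prop) : Prop :=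
  (∀ x y, o x y → G.Adj x y ∧ x ∈ H ∧ y ∈ H) ∧ (∀ x y, o x y → ¬ o y x)

/-- Invariant while ears are added to `S`. -/
def EarInv (G : SimpleGraph V) (c : V) (m D : ℕ) (S H : Set V) (o : V → V → Prop) : Prop :=
  POr G H o ∧ S ⊆ H ∧ (∀ v ∈ S, DW o D c v ∧ DW o D v c) ∧
    ∀ v ∈ H, ∃ i j, i ≤ m ∧ j ≤ m ∧ DW o (D + i) c v ∧ DW o (D + j) v c ∧
      ∀ t ∈ S, min i j ≤ G.dist v t

theorem EarInv.flip {G : SimpleGraph V} {c : V} {m D : ℕ} {S H : Set V} {o : V → V → Prop}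
    (h : EarInv G c m D S H o) : EarInv G c m D S H (fun a b => o b a) := by
  obtain ⟨⟨h1, h2⟩, h3, h4, h5⟩ := h
  refine ⟨⟨fun x y hxy => ?_, fun x y hxy => h2 _ _ hxy⟩, h3, fun v hv => ?_, fun v hv => ?_⟩
  · obtain ⟨a, b, c⟩ := h1 _ _ hxy
    exact ⟨a.symm, c, b⟩
  · exact ⟨(h4 v hv).2.flip, (h4 v hv).1.flip⟩
  · obtain ⟨i, j, hi, hj, hw, hw', ht⟩ := h5 v hv
    exact ⟨j, i, hj, hi, hw'.flip, hw.flip, fun t h => by rw [min_comm]; exact ht t h⟩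

theorem add_ear_aux {G : SimpleGraph V} {c : V} {m D : ℕ} {S H : Set V} {o : V → V → Prop}
    (h : EarInv G c m D S H o) {s : V} (hs : s ∈ S) (v : ℕ → V) (a L : ℕ)
    (haL : a ≤ L) (hLm : L ≤ m) (hsv : G.Adj s (v 0))
    (hadj : ∀ i < a, G.Adj (v i) (v (i + 1))) (hnot : ∀ i < a, v i ∉ H) (hy : v a ∈ H)
    (h1 : v 1 ≠ s) (hinj : ∀ i ≤ a, ∀ j ≤ a, v i = v j → i = j) (ha : 0 < a)
    (hkey : ∀ i < a, ∀ t ∈ S, min (i + 1) (L - i) ≤ G.dist (v i) t)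
    (j : ℕ) (hj : j ≤ L - a) (hyc : DW o (D + j) (v a) c) :
    ∃ H' o', EarInv G c m D S H' o' ∧ H ⊆ H' ∧ v 0 ∈ H' := by
  obtain ⟨⟨p1, p2⟩, p3, p4, p5⟩ := h
  set o' : V → V → Prop := fun u w =>
    o u w ∨ (u = s ∧ w = v 0) ∨ ∃ i < a, u = v i ∧ w = v (i + 1) with ho'
  have hoo : ∀ x y, o x y → o' x y := fun x y h => Or.inl h
  have hsH := p3 hs
  have hfrom : ∀ i ≤ a, DW o' (D + (i + 1)) c (v i) := by
    intro i
    induction i with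
    | zero =>
      intro _
      exact ((p4 s hs).1.mono hoo D le_rfl).trans
        (DW.step (n := 0) (Or.inr (Or.inl ⟨rfl, rfl⟩)) (DW.refl _ _))
    | succ i ih =>
      intro hi
      exact (ih (by omega)).trans
        (DW.step (n := 0) (Or.inr (Or.inr ⟨i, by omega, rfl, rfl⟩)) (DW.refl _ _))
  have hto : ∀ i ≤ a, DW o' (D + j + i) (v (a - i)) c := by
    intro i
    induction i with
    | zero => intro _; exact hyc.mono hoo _ le_rfl
    | succ i ih =>
      intro hi
      refine DW.step (n := D + j + i) (Or.inr (Or.inr ⟨a - (i + 1), by omega, rfl, rfl⟩)) ?_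
      rw [show a - (i + 1) + 1 = a - i by omega]
      exact ih (by omega)
  have hmem : ∀ i ≤ a, v i ∈ H ∪ {u | ∃ i < a, u = v i} := by
    intro i hi
    rcases hi.lt_or_eq with h | h
    · exact Or.inr ⟨i, h, rfl⟩
    · subst h; exact Or.inl hy
  refine ⟨H ∪ {u | ∃ i < a, u = v i}, o', ⟨⟨?_, ?_⟩, ?_, ?_, ?_⟩, ?_, ?_⟩
  · rintro x y (h | ⟨rfl, rfl⟩ | ⟨i, hi, rfl, rfl⟩)
    · exact ⟨(p1 _ _ h).1, Or.inl (p1 _ _ h).2.1, Or.inl (p1 _ _ h).2.2⟩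
    · exact ⟨hsv, Or.inl hsH, hmem 0 (by omega)⟩
    · exact ⟨hadj i hi, hmem i (by omega), hmem _ (by omega)⟩
  · rintro x y (h | ⟨hx, hy'⟩ | ⟨i, hi, hx, hy'⟩) (h' | ⟨hx', hy''⟩ | ⟨i', hi', hx', hy''⟩)
    · exact p2 _ _ h h'
    · exact hnot 0 ha (hy'' ▸ (p1 _ _ h).2.1)
    · exact hnot i' hi' (hx' ▸ (p1 _ _ h).2.2)
    · exact hnot 0 ha (hy' ▸ (p1 _ _ h').2.1)
    · exact hnot 0 ha (by rw [← hy', hx']; exact hsH)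
    · have := hinj 0 (by omega) i' (by omega) (hy'.symm.trans hx')
      subst this
      exact h1 (hy''.symm.trans hx)
    · exact hnot i hi (hx ▸ (p1 _ _ h').2.2)
    · have := hinj 0 (by omega) i (by omega) (hy''.symm.trans hx)
      subst this
      exact h1 (hy'.symm.trans hx')
    · have e1 := hinj _ (by omega) _ (by omega) (hx.symm.trans hy'')
      have e2 := hinj _ (by omega) _ (by omega) (hy'.symm.trans hx')
      omega
  · exact fun x hx => Or.inl (p3 hx)
  · exact fun x hx => ⟨(p4 x hx).1.mono hoo _ le_rfl, (p4 x hx).2.mono hoo _ le_rfl⟩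
  · rintro u (hu | ⟨i, hi, rfl⟩)
    · obtain ⟨i, j, hi, hj, hw, hw', ht⟩ := p5 u hu
      exact ⟨i, j, hi, hj, hw.mono hoo _ le_rfl, hw'.mono hoo _ le_rfl, ht⟩
    · refine ⟨i + 1, L - i, by omega, by omega, hfrom i hi.le, ?_, hkey i hi⟩
      have := hto (a - i) (by omega)
      rw [show a - (a - i) = i by omega] at this
      exact this.mono (fun _ _ h => h) _ (by omega)
  · exact fun x hx => Or.inl hx
  · exact hmem 0 (by omega)

theorem walk_split {G : SimpleGraph V} {S : Set V} {s x : V} (hs : s ∈ S) {w t : V}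
    (R : G.Walk w t) (ht : t ∈ S) :
    (∃ t' ∈ S, ∃ q : (G.deleteEdges {s(s, x)}).Walk w t', q.length ≤ R.length) ∨
    (∃ q : (G.deleteEdges {s(s, x)}).Walk w x, q.length + 1 ≤ R.length) := by
  induction R with
  | nil => exact Or.inl ⟨_, ht, Walk.nil, by simp⟩
  | @cons a b c hab R ih =>
    by_cases he : s(a, b) = s(s, x)
    · rcases Sym2.eq_iff.1 he with ⟨rfl, rfl⟩ | ⟨rfl, rfl⟩
      · exact Or.inl ⟨_, hs, Walk.nil, by simp⟩
      · exact Or.inr ⟨Walk.nil, by simp⟩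
    · have hab' : (G.deleteEdges {s(s, x)}).Adj a b := by
        rw [deleteEdges_adj]; exact ⟨hab, he⟩
      rcases ih ht with ⟨t', ht', q, hq⟩ | ⟨q, hq⟩
      · exact Or.inl ⟨t', ht', Walk.cons hab' q, by simp; omega⟩
      · exact Or.inr ⟨Walk.cons hab' q, by simp; omega⟩

theorem add_ear {G : SimpleGraph V} (hconn : G.Preconnected) {c : V} {m D : ℕ} {S H : Set V}
    {o : V → V → Prop}
    (hcyc : ∀ u v, G.Adj u v → ∃ q : (G.deleteEdges {s(u, v)}).Walk v u, q.length ≤ m)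
    (h : EarInv G c m D S H o) {s x : V} (hs : s ∈ S) (hx : x ∉ H) (hsx : G.Adj s x) :
    ∃ H' o', EarInv G c m D S H' o' ∧ H ⊆ H' ∧ x ∈ H' := by
  classical
  have hex : ∃ n, ∃ t ∈ S, ∃ q : (G.deleteEdges {s(s, x)}).Walk x t, q.length = n := by
    obtain ⟨q, _⟩ := hcyc s x hsx
    exact ⟨_, s, hs, q, rfl⟩
  obtain ⟨L, hL⟩ : ∃ L, L = Nat.find hex := ⟨_, rfl⟩
  obtain ⟨t, ht, p, hp⟩ := hL ▸ Nat.find_spec hex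
  have hmin : ∀ t' ∈ S, ∀ q : (G.deleteEdges {s(s, x)}).Walk x t', L ≤ q.length := by
    intro t' ht' q
    rw [hL]; exact Nat.find_min' hex ⟨t', ht', q, rfl⟩
  have hLm : L ≤ m := by
    obtain ⟨q, hq⟩ := hcyc s x hsx
    exact (hmin s hs q).trans hq
  have hpath : ∀ i ≤ L, ∀ j ≤ L, p.getVert i = p.getVert j → i = j := by
    have : ∀ i j, i < j → j ≤ L → p.getVert i ≠ p.getVert j := by
      intro i j hij hj he
      have := hmin t ht ((p.take i).append ((p.drop j).copy he.symm rfl))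
      simp at this
      omega
    intro i hi j hj he
    rcases lt_trichotomy i j with h | h | h
    · exact absurd he (this i j h hj)
    · exact h
    · exact absurd he.symm (this j i h hi)
  have hkey : ∀ i ≤ L, ∀ t' ∈ S, min (i + 1) (L - i) ≤ G.dist (p.getVert i) t' := by
    intro i hi t' ht'
    obtain ⟨R, hR⟩ := (hconn (p.getVert i) t').exists_walk_length_eq_dist
    rw [← hR]
    rcases walk_split (x := x) hs R ht' with ⟨t'', ht'', q, hq⟩ | ⟨q, hq⟩
    · have := hmin t'' ht'' ((p.take i).append q)
      simp at this
      omega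
    · have := hmin t ht (q.reverse.append (p.drop i))
      simp at this
      omega
  have hexa : ∃ a, p.getVert a ∈ H := ⟨L, by rw [← hp, Walk.getVert_length]; exact h.2.1 ht⟩
  obtain ⟨a, haH, hnot⟩ : ∃ a, p.getVert a ∈ H ∧ ∀ i < a, p.getVert i ∉ H :=
    ⟨Nat.find hexa, Nat.find_spec hexa, fun i hi => Nat.find_min hexa hi⟩
  have haL : a ≤ L := by
    by_contra hcon
    exact hnot L (by omega) (by rw [← hp, Walk.getVert_length]; exact h.2.1 ht)
  have ha0 : 0 < a := by
    rcases Nat.eq_zero_or_pos a with h0 | h0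
    · subst h0; simp at haH; exact absurd haH hx
    · exact h0
  have hadj' : ∀ i < a, (G.deleteEdges {s(s, x)}).Adj (p.getVert i) (p.getVert (i + 1)) :=
    fun i hi => p.adj_getVert_succ (by omega)
  have hadj : ∀ i < a, G.Adj (p.getVert i) (p.getVert (i + 1)) :=
    fun i hi => (deleteEdges_adj.1 (hadj' i hi)).1
  have h1 : p.getVert 1 ≠ s := by
    intro he
    have := (deleteEdges_adj.1 (hadj' 0 ha0)).2
    apply this
    simp [he, Sym2.eq_swap]
  have hdist : G.dist (p.getVert a) t ≤ L - a := by
    have := dist_le ((p.drop a).mapLe (deleteEdges_le _))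
    simp at this
    omega
  have hsx' : G.Adj s (p.getVert 0) := by simpa using hsx
  obtain ⟨i, j, hi, hj, hw, hw', hij⟩ := h.2.2.2 _ haH
  have hij := (hij t ht).trans hdist
  have hfin : ∃ H' o', EarInv G c m D S H' o' ∧ H ⊆ H' ∧ p.getVert 0 ∈ H' := by
    rcases min_le_iff.1 hij with h' | h'
    · obtain ⟨H', o', r1, r2, r3⟩ := add_ear_aux h.flip hs p.getVert a L haL hLm hsx' hadj hnot haH
        h1 (fun i hi j hj => hpath i (by omega) j (by omega)) ha0
        (fun i hi => hkey i (by omega)) i h' hw.flip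
      exact ⟨H', o', r1, r2, r3⟩
    · exact add_ear_aux h hs p.getVert a L haL hLm hsx' hadj hnot haH
        h1 (fun i hi j hj => hpath i (by omega) j (by omega)) ha0
        (fun i hi => hkey i (by omega)) j h' hw'
  simpa using hfin

theorem ear_complete [Finite V] {G : SimpleGraph V} (hconn : G.Preconnected) {c : V} {m D : ℕ}
    {S : Set V}
    (hcyc : ∀ u v, G.Adj u v → ∃ q : (G.deleteEdges {s(u, v)}).Walk v u, q.length ≤ m) :
    ∀ (n : ℕ) (H : Set V) (o : V → V → Prop), (Hᶜ).ncard = n → EarInv G c m D S H o →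
    ∃ H' o', EarInv G c m D S H' o' ∧ ∀ s ∈ S, ∀ x, G.Adj s x → x ∈ H' := by
  intro n
  induction n using Nat.strong_induction_on with
  | _ n ih =>
    intro H o hn h
    by_cases hall : ∀ s ∈ S, ∀ x, G.Adj s x → x ∈ H
    · exact ⟨H, o, h, hall⟩
    · push Not at hall
      obtain ⟨s, hs, x, hsx, hx⟩ := hall
      obtain ⟨H', o', h', hsub, hx'⟩ := add_ear hconn hcyc h hs hx hsx
      refine ih (H'ᶜ).ncard ?_ H' o' rfl h'
      rw [← hn]
      refine Set.ncard_lt_ncard ?_ (Set.toFinite _)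
      refine ⟨Set.compl_subset_compl.2 hsub, fun hc => hc hx hx'⟩

theorem layers [Finite V] {G : SimpleGraph V} (hconn : G.Preconnected) (c : V) (m : ℕ)
    (hcyc : ∀ u v, G.Adj u v → ∃ q : (G.deleteEdges {s(u, v)}).Walk v u, q.length ≤ m) (r : ℕ) :
    ∃ (S : Set V) (o : V → V → Prop), POr G S o ∧ (∀ v ∈ S, DW o (m * r) c v ∧ DW o (m * r) v c) ∧
      ∀ v, G.dist c v ≤ r → v ∈ S := by
  induction r with
  | zero =>
    refine ⟨{c}, fun _ _ => False, ⟨by simp, by simp⟩, ?_, ?_⟩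
    · rintro v rfl; exact ⟨DW.refl _ _, DW.refl _ _⟩
    · intro v hv
      have := (hconn c v).dist_eq_zero_iff.1 (by omega)
      exact this.symm
  | succ r ih =>
    obtain ⟨S, o, h1, h2, h3⟩ := ih
    have h0 : EarInv G c m (m * r) S S o :=
      ⟨h1, subset_rfl, h2, fun v hv => ⟨0, 0, by simp, by simp, (h2 v hv).1, (h2 v hv).2, by simp⟩⟩
    obtain ⟨H, o', h', hall⟩ := ear_complete hconn hcyc _ S o rfl h0
    refine ⟨H, o', h'.1, ?_, ?_⟩
    · intro v hv
      obtain ⟨i, j, hi, hj, hw, hw', _⟩ := h'.2.2.2 v hv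
      exact ⟨hw.mono (fun _ _ h => h) _ (by rw [Nat.mul_succ]; omega),
        hw'.mono (fun _ _ h => h) _ (by rw [Nat.mul_succ]; omega)⟩
    · intro v hv
      by_cases hle : G.dist c v ≤ r
      · exact h'.2.1 (h3 v hle)
      · obtain ⟨p, hp⟩ := (hconn c v).exists_walk_length_eq_dist
        have hpr : p.length = r + 1 := by omega
        refine hall (p.getVert r) (h3 _ ?_) v ?_
        · have := dist_le (p.take r)
          simp at this
          omega
        · have := p.adj_getVert_succ (i := r) (by omega)
          rwa [← hpr, Walk.getVert_length] at this

theorem extend_or {G : SimpleGraph V} {H : Set V} {o : V → V → Prop} (h : POr G H o) :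
    ∃ o', IsOrientation G o' ∧ ∀ x y, o x y → o' x y := by
  refine ⟨fun x y => o x y ∨ (G.Adj x y ∧ ¬ o y x ∧ WellOrderingRel x y), ⟨?_, ?_, ?_⟩,
    fun x y h => Or.inl h⟩
  · rintro x y (h' | h')
    · exact (h.1 _ _ h').1
    · exact h'.1
  · intro x y hxy
    by_cases h1 : o x y
    · exact Or.inl (Or.inl h1)
    by_cases h2 : o y x
    · exact Or.inr (Or.inl h2)
    rcases trichotomous_of WellOrderingRel x y with h' | h' | h'
    · exact Or.inl (Or.inr ⟨hxy, h2, h'⟩)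
    · exact absurd h' hxy.ne
    · exact Or.inr (Or.inr ⟨hxy.symm, h1, h'⟩)
  · rintro x y (h1 | ⟨_, h1, h1'⟩) (h2 | ⟨_, h2, h2'⟩)
    · exact h.2 _ _ h1 h2
    · exact h2 h1
    · exact h1 h2
    · exact asymm h1' h2'

theorem walk_avoid {G : SimpleGraph V} {u v : V} {k : ℕ} {a w : V} (R : G.Walk a w)
    (hu : G.dist u w = k) (hv : G.dist v w = k) (hR : R.length ≤ k) :
    ∃ q : (G.deleteEdges {s(u, v)}).Walk a w, q.length ≤ R.length := by
  induction R with
  | nil => exact ⟨Walk.nil, by simp⟩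
  | @cons a b c hab R ih =>
    simp only [Walk.length_cons] at hR ⊢
    by_cases he : s(a, b) = s(u, v)
    · have := dist_le R
      rcases Sym2.eq_iff.1 he with ⟨rfl, rfl⟩ | ⟨rfl, rfl⟩ <;> omega
    · have hab' : (G.deleteEdges {s(u, v)}).Adj a b := by
        rw [deleteEdges_adj]; exact ⟨hab, he⟩
      obtain ⟨q, hq⟩ := ih hu hv (by omega)
      exact ⟨Walk.cons hab' q, by simp; omega⟩

theorem common_nbr [Fintype V] (G : SimpleGraph V) (k : ℕ) (hk : 2 ≤ k)
    (hN : ∀ u : V, (Fintype.card V : ℤ) - 2 < 2 * ({v : V | G.dist u v = k} : Set V).ncard)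
    {u v : V} (huv : u ≠ v) (hd : G.dist u v ≠ k) : ∃ w, G.dist u w = k ∧ G.dist v w = k := by
  by_contra hcon
  push Not at hcon
  have hdis : Disjoint {w : V | G.dist u w = k} {w : V | G.dist v w = k} :=
    Set.disjoint_left.2 fun w h1 h2 => hcon w h1 h2
  have hdis2 : Disjoint ({w : V | G.dist u w = k} ∪ {w : V | G.dist v w = k}) {u, v} := by
    refine Set.disjoint_right.2 ?_
    rintro w (rfl | rfl) (h | h)
    · simp at h; omega
    · rw [Set.mem_setOf_eq, dist_comm] at h; exact hd h
    · exact hd h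
    · simp at h; omega
  have h1 := Set.ncard_union_eq hdis (Set.toFinite _) (Set.toFinite _)
  have h2 := Set.ncard_union_eq hdis2 (Set.toFinite _) (Set.toFinite _)
  have h3 := Set.ncard_le_card
    ({w : V | G.dist u w = k} ∪ {w : V | G.dist v w = k} ∪ ({u, v} : Set V))
  rw [Set.ncard_pair huv] at h2
  rw [Nat.card_eq_fintype_card] at h3
  have := hN u
  have := hN v
  omega

/-- If `k ≥ 2` and every vertex `u` of an `n`-vertex graph `G` satisfies
`|N_k(u)| > n/2 - 1` (i.e. `2|N_k(u)| > n - 2`), then `G` admits an orientation of radius at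
most `4k²` and an orientation of diameter at most `8k²`. -/
theorem oriented_bounds_large_kth_neighborhood [Fintype V] [Nonempty V]
    (G : SimpleGraph V) (k : ℕ) (hk : 2 ≤ k)
    (hN : ∀ u : V, (Fintype.card V : ℤ) - 2 < 2 * ({v : V | G.dist u v = k} : Set V).ncard) :
    OrientRadiusLE G (4 * k ^ 2) ∧ OrientDiamLE G (8 * k ^ 2) := by
  have hwalk : ∀ u v : V, ∃ p : G.Walk u v, p.length ≤ 2 * k := by
    intro u v
    by_cases huv : u = v
    · subst huv; exact ⟨Walk.nil, by simp⟩
    by_cases hd : G.dist u v = k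
    · obtain ⟨p, hp⟩ := (Reachable.of_dist_ne_zero (G := G) (u := u) (v := v)
        (by omega)).exists_walk_length_eq_dist
      exact ⟨p, by omega⟩
    · obtain ⟨w, h1, h2⟩ := common_nbr G k hk hN huv hd
      obtain ⟨p, hp⟩ := (Reachable.of_dist_ne_zero (G := G) (u := u) (v := w)
        (by omega)).exists_walk_length_eq_dist
      obtain ⟨q, hq⟩ := (Reachable.of_dist_ne_zero (G := G) (u := v) (v := w)
        (by omega)).exists_walk_length_eq_dist
      exact ⟨p.append q.reverse, by simp; omega⟩
  have hconn : G.Preconnected := fun u v => (hwalk u v).choose.reachable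
  have hcyc : ∀ u v, G.Adj u v →
      ∃ q : (G.deleteEdges {s(u, v)}).Walk v u, q.length ≤ 2 * k := by
    intro u v huv
    obtain ⟨w, h1, h2⟩ := common_nbr G k hk hN huv.ne (by rw [dist_eq_one_iff_adj.2 huv]; omega)
    obtain ⟨p, hp⟩ := (hconn u w).exists_walk_length_eq_dist
    obtain ⟨q, hq⟩ := (hconn v w).exists_walk_length_eq_dist
    obtain ⟨p', hp'⟩ := walk_avoid p h1 h2 (by omega)
    obtain ⟨q', hq'⟩ := walk_avoid q h1 h2 (by omega)
    exact ⟨q'.append p'.reverse, by simp; omega⟩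
  obtain ⟨c⟩ := ‹Nonempty V›
  obtain ⟨S, o, h1, h2, h3⟩ := layers hconn c (2 * k) hcyc (2 * k)
  obtain ⟨o', ho', hoo⟩ := extend_or h1
  have hall : ∀ v, DW o' (4 * k ^ 2) c v ∧ DW o' (4 * k ^ 2) v c := by
    intro v
    have hv : v ∈ S := h3 v (by
      obtain ⟨p, hp⟩ := hwalk c v
      exact (dist_le p).trans hp)
    have he : 2 * k * (2 * k) ≤ 4 * k ^ 2 := le_of_eq (by ring)
    exact ⟨(h2 v hv).1.mono hoo _ he, (h2 v hv).2.mono hoo _ he⟩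
  refine ⟨⟨o', ho', c, fun v => ⟨(hall v).1.toPath, (hall v).2.toPath⟩⟩, o', ho', fun x y => ?_⟩
  have := (hall x).2.trans (hall y).1
  exact (this.mono (fun _ _ h => h) (8 * k ^ 2) (by omega)).toPath
end

section
/- Let G be a finite connected bridgeless edge-transitive graph with at least one edge, let g be the girth of G, and let r ≥ 1 be an integer such that some vertex u of G satisfies d_G(u,v) ≤ r for every vertex v (i.e., rad(G) ≤ r). Then G admits a rainbow coloring with r·g colors, i.e., rc(G) ≤ r·g. -/
open SimpleGraph Finset

variable {V : Type*}

/-- `G` is edge-transitive: any edge can be mapped onto any other edge by an automorphism. -/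
def EdgeTransitive (G : SimpleGraph V) : Prop :=
  ∀ e₁ ∈ G.edgeSet, ∀ e₂ ∈ G.edgeSet, ∃ φ : G ≃g G, Sym2.map ⇑φ e₁ = e₂

/-- Every walk from `v` to `D` has length at least `n`. -/
def FarFrom (G : SimpleGraph V) (D : Set V) (v : V) (n : ℕ) : Prop :=
  ∀ z ∈ D, ∀ w : G.Walk v z, n ≤ w.length

/-- Both ends of `e` are in `S`. -/
def EdgeIn (S : Set V) (e : Sym2 V) : Prop := ∀ a ∈ e, a ∈ S

/-- There is a rainbow walk from `v` to `D` using edges in `S`, not in `D`, with colors in `P`. -/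
def GoodTo (G : SimpleGraph V) (D S : Set V) (f : Sym2 V → ℕ) (P : ℕ → Prop) (v : V) : Prop :=
  ∃ z ∈ D, ∃ w : G.Walk v z,
    (∀ e ∈ w.edges, EdgeIn S e ∧ ¬ EdgeIn D e ∧ P (f e)) ∧ (w.edges.map f).Nodup

/-- The invariant of the ear growing process. -/
def EarState (G : SimpleGraph V) (D : Set V) (g : ℕ) (S : Set V) (f : Sym2 V → ℕ) : Prop :=
  D ⊆ S ∧ ∀ v ∈ S, ∃ k ≤ g, (FarFrom G D v k ∨ FarFrom G D v (g - k)) ∧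
    GoodTo G D S f (fun t => t < k) v ∧ GoodTo G D S f (fun t => k ≤ t ∧ t < g) v

lemma GoodTo.nil {G : SimpleGraph V} {D S : Set V} {f : Sym2 V → ℕ} {P : ℕ → Prop} {v : V}
    (hv : v ∈ D) : GoodTo G D S f P v :=
  ⟨v, hv, Walk.nil, by simp, by simp⟩

lemma GoodTo.step {G : SimpleGraph V} {D S : Set V} {f : Sym2 V → ℕ} {P Q : ℕ → Prop} {v v' : V}
    (h : GoodTo G D S f P v) (ha : G.Adj v' v) (hS : EdgeIn S s(v', v))
    (hD : ¬ EdgeIn D s(v', v)) (hPQ : ∀ t, P t → Q t) (hP : ¬ P (f s(v', v)))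
    (hQ : Q (f s(v', v))) : GoodTo G D S f Q v' := by
  obtain ⟨z, hz, w, hw, hn⟩ := h
  refine ⟨z, hz, Walk.cons ha w, ?_, ?_⟩
  · intro e he
    rw [Walk.edges_cons, List.mem_cons] at he
    rcases he with rfl | he
    · exact ⟨hS, hD, hQ⟩
    · exact ⟨(hw e he).1, (hw e he).2.1, hPQ _ (hw e he).2.2⟩
  · rw [Walk.edges_cons, List.map_cons, List.nodup_cons]
    refine ⟨?_, hn⟩
    intro hmem
    obtain ⟨e, he, hee⟩ := List.mem_map.1 hmem
    exact hP (hee ▸ (hw e he).2.2)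

lemma GoodTo.congr {G : SimpleGraph V} {D S S' : Set V} {f f' : Sym2 V → ℕ} {P Q : ℕ → Prop}
    {v : V} (h : GoodTo G D S f P v) (hS : S ⊆ S')
    (hf : ∀ e, EdgeIn S e → P (f e) → Q (f' e))
    (hinj : ∀ e e', EdgeIn S e → EdgeIn S e' → P (f e) → P (f e') → f' e = f' e' → f e = f e') :
    GoodTo G D S' f' Q v := by
  obtain ⟨z, hz, w, hw, hn⟩ := h
  refine ⟨z, hz, w, ?_, ?_⟩
  · intro e he
    obtain ⟨h1, h2, h3⟩ := hw e he
    exact ⟨fun a ha => hS (h1 a ha), h2, hf e h1 h3⟩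
  · have h0 : w.edges.Nodup := List.Nodup.of_map _ hn
    refine List.Nodup.map_on ?_ h0
    intro e he e' he' hee
    exact List.inj_on_of_nodup_map hn he he'
      (hinj e e' (hw e he).1 (hw e' he').1 (hw e he).2.2 (hw e' he').2.2 hee)

lemma EarState.reflect {G : SimpleGraph V} {D S : Set V} {g : ℕ} {f : Sym2 V → ℕ}
    (h : EarState G D g S f) : EarState G D g S (fun e => g - 1 - f e) := by
  refine ⟨h.1, fun v hv => ?_⟩
  obtain ⟨k, hk, hfar, hl, hr⟩ := h.2 v hv
  refine ⟨g - k, by omega, ?_, ?_, ?_⟩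
  · rw [show g - (g - k) = k by omega]
    exact hfar.symm
  · exact hr.congr subset_rfl (fun e _ h => by omega) (fun e e' _ _ h h' h'' => by omega)
  · exact hl.congr subset_rfl (fun e _ h => by omega) (fun e e' _ _ h h' h'' => by omega)

/-- Data of an ear. -/
structure EarData (G : SimpleGraph V) (D : Set V) (g p : ℕ) (X : ℕ → V) : Prop where
  ple : p ≤ g
  ppos : 1 ≤ p
  zero : X 0 ∈ D
  last : X p ∈ D
  adj : ∀ i < p, G.Adj (X i) (X (i + 1))
  inj : ∀ i < p, ∀ i' < p, s(X i, X (i + 1)) = s(X i', X (i' + 1)) → i = i'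
  far : ∀ i, 1 ≤ i → i ≤ p → FarFrom G D (X i) (min i (p - i))
  near : ∀ i, 1 ≤ i → i ≤ p → ∀ n, FarFrom G D (X i) n → n ≤ p - i

lemma core_extend {G : SimpleGraph V} {D S : Set V} {g p j k : ℕ} {X : ℕ → V} {f : Sym2 V → ℕ}
    (hst : EarState G D g S f) (hX : EarData G D g p X) (hj1 : 1 < j) (hjp : j ≤ p)
    (hjS : X j ∈ S) (hnS : ∀ i, 1 ≤ i → i < j → X i ∉ S) (hk : k ≤ g)
    (hfar : FarFrom G D (X j) (g - k))
    (hright : GoodTo G D S f (fun t => k ≤ t ∧ t < g) (X j)) :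
    ∃ f', EarState G D g (S ∪ {v | ∃ i, 1 ≤ i ∧ i < j ∧ v = X i}) f' := by
  classical
  set S' : Set V := S ∪ {v | ∃ i, 1 ≤ i ∧ i < j ∧ v = X i} with hS'
  have hple := hX.ple
  have hnear := hX.near j (by omega) hjp _ hfar
  have hjk : j ≤ k := by omega
  obtain ⟨K, hK⟩ : ∃ K : ℕ → ℕ, ∀ i, K i = if i < j then (if 2 * i ≤ p then i else k - (j - i))
    else k := ⟨_, fun i => rfl⟩
  have hKj : K j = k := by rw [hK]; simp
  have hKlt : ∀ i < j, K i < K (i + 1) := by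
    intro i hi
    rw [hK, hK]
    split_ifs <;> omega
  have hKle : ∀ i ≤ j, K i ≤ k := by
    intro i hi
    rw [hK]
    split_ifs <;> omega
  let f' : Sym2 V → ℕ := fun e =>
    if h : ∃ i, i < j ∧ e = s(X i, X (i + 1)) then K h.choose else f e
  have hf'1 : ∀ i < j, f' s(X i, X (i + 1)) = K i := by
    intro i hi
    have h : ∃ i', i' < j ∧ s(X i, X (i + 1)) = s(X i', X (i' + 1)) := ⟨i, hi, rfl⟩
    have h2 := h.choose_spec
    have h3 : i = h.choose := hX.inj i (by omega) _ (by omega) h2.2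
    simp only [f', dif_pos h]
    rw [← h3]
  have hout : ∀ i < j, ¬ EdgeIn S s(X i, X (i + 1)) := by
    intro i hi hin
    rcases Nat.eq_zero_or_pos i with rfl | h0
    · exact hnS 1 le_rfl hj1 (hin _ (by simp))
    · exact hnS i h0 hi (hin _ (by simp))
  have houtD : ∀ i < j, ¬ EdgeIn D s(X i, X (i + 1)) :=
    fun i hi hin => hout i hi (fun a ha => hst.1 (hin a ha))
  have hf'2 : ∀ e, EdgeIn S e → f' e = f e := by
    intro e he
    have h : ¬ ∃ i, i < j ∧ e = s(X i, X (i + 1)) := by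
      rintro ⟨i, hi, rfl⟩
      exact hout i hi he
    simp only [f', dif_neg h]
  have hSS' : S ⊆ S' := Set.subset_union_left
  have hXS' : ∀ i ≤ j, X i ∈ S' := by
    intro i hi
    rcases Nat.eq_zero_or_pos i with rfl | h0
    · exact hSS' (hst.1 hX.zero)
    rcases hi.lt_or_eq with h | rfl
    · exact Or.inr ⟨i, h0, h, rfl⟩
    · exact hSS' hjS
  have hin : ∀ i < j, EdgeIn S' s(X i, X (i + 1)) := by
    intro i hi a ha
    rcases Sym2.mem_iff.1 ha with rfl | rfl
    · exact hXS' _ hi.le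
    · exact hXS' _ hi
  have hcongr : ∀ P v, GoodTo G D S f P v → GoodTo G D S' f' P v := by
    intro P v h
    refine h.congr hSS' ?_ ?_
    · intro e he hp
      rwa [hf'2 e he]
    · intro e e' he he' _ _ h
      rwa [hf'2 e he, hf'2 e' he'] at h
  have hL : ∀ i < j, GoodTo G D S' f' (fun t => t < K i) (X i) := by
    intro i
    induction i with
    | zero => intro _; exact GoodTo.nil hX.zero
    | succ i ih =>
      intro hi
      have hi' : i < j := by omega
      have hKi := hKlt i hi'
      refine (ih hi').step (hX.adj i (by omega)).symm ?_ ?_ ?_ ?_ ?_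
      · rw [Sym2.eq_swap]; exact hin i hi'
      · rw [Sym2.eq_swap]; exact houtD i hi'
      · intro t ht; omega
      · rw [Sym2.eq_swap, hf'1 i hi']; omega
      · rw [Sym2.eq_swap, hf'1 i hi']; exact hKi
  have hR : ∀ m i, i + m = j → GoodTo G D S' f' (fun t => K i ≤ t ∧ t < g) (X i) := by
    intro m
    induction m with
    | zero =>
      intro i hi
      obtain rfl : i = j := by omega
      rw [hKj]
      exact hcongr _ _ hright
    | succ m ih =>
      intro i hi
      have hi' : i < j := by omega
      have hKi := hKlt i hi'
      have hKi2 := hKle (i + 1) hi'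
      refine (ih (i + 1) (by omega)).step (hX.adj i (by omega)) (hin i hi') (houtD i hi') ?_ ?_ ?_
      · intro t ht; omega
      · rw [hf'1 i hi']; omega
      · rw [hf'1 i hi']; omega
  refine ⟨f', fun v hv => hSS' (hst.1 hv), ?_⟩
  rintro v (hv | ⟨i, hi1, hij, rfl⟩)
  · obtain ⟨k', hk', hfar', hl, hr⟩ := hst.2 v hv
    exact ⟨k', hk', hfar', hcongr _ _ hl, hcongr _ _ hr⟩
  · refine ⟨K i, (hKle i hij.le).trans hk, ?_, hL i hij, hR (j - i) i (by omega)⟩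
    have hd := hX.far i hi1 (by omega)
    by_cases h2 : 2 * i ≤ p
    · left
      intro z hz w
      have := hd z hz w
      rw [hK, if_pos hij, if_pos h2]
      omega
    · right
      intro z hz w
      have := hd z hz w
      rw [hK, if_pos hij, if_neg h2]
      omega

lemma extend {G : SimpleGraph V} {D S : Set V} {g p : ℕ} {X : ℕ → V} {f : Sym2 V → ℕ}
    (hst : EarState G D g S f) (hX : EarData G D g p X) (h1 : X 1 ∉ S) :
    ∃ S' f', EarState G D g S' f' ∧ S ⊆ S' ∧ X 1 ∈ S' := by
  classical
  have hex : ∃ j, 1 ≤ j ∧ X j ∈ S := ⟨p, hX.ppos, hst.1 hX.last⟩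
  obtain ⟨hj0, hjS⟩ := Nat.find_spec hex
  have hjp : Nat.find hex ≤ p := Nat.find_min' hex ⟨hX.ppos, hst.1 hX.last⟩
  have hmin : ∀ i, 1 ≤ i → i < Nat.find hex → X i ∉ S :=
    fun i hi hlt hS => Nat.find_min hex hlt ⟨hi, hS⟩
  generalize Nat.find hex = j at *
  have hj1 : 1 < j := by
    rcases hj0.lt_or_eq with h | rfl
    · exact h
    · exact absurd hjS h1
  obtain ⟨k, hk, hfar, hl, hr⟩ := hst.2 _ hjS
  have : ∃ f', EarState G D g (S ∪ {v | ∃ i, 1 ≤ i ∧ i < j ∧ v = X i}) f' := by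
    rcases hfar with hfar | hfar
    · refine core_extend hst.reflect hX hj1 hjp hjS hmin (Nat.sub_le g k) ?_ ?_
      · rw [show g - (g - k) = k by omega]; exact hfar
      · exact hl.congr subset_rfl (fun e _ h => by omega) (fun e e' _ _ h h' h'' => by omega)
    · exact core_extend hst hX hj1 hjp hjS hmin hk hfar hr
  obtain ⟨f', hf'⟩ := this
  exact ⟨_, f', hf', Set.subset_union_left, Or.inr ⟨1, le_rfl, hj1, rfl⟩⟩

/-- Any walk to `D` yields a walk in `G - xy` to `D` or to `y`, of controlled length. -/
lemma avoid_edge {G : SimpleGraph V} {D : Set V} {x y : V} (hx : x ∈ D) {v z : V}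
    (w : G.Walk v z) (hz : z ∈ D) :
    (∃ z' ∈ D, ∃ w' : (G.deleteEdges {s(x, y)}).Walk v z', w'.length ≤ w.length) ∨
    (∃ w' : (G.deleteEdges {s(x, y)}).Walk v y, w'.length + 1 ≤ w.length) := by
  induction w with
  | nil => exact Or.inl ⟨_, hz, Walk.nil, by simp⟩
  | @cons a b c h w ih =>
    by_cases he : s(a, b) = s(x, y)
    · rcases Sym2.eq_iff.1 he with ⟨rfl, rfl⟩ | ⟨rfl, rfl⟩
      · exact Or.inl ⟨_, hx, Walk.nil, by simp⟩
      · exact Or.inr ⟨Walk.nil, by simp⟩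
    · have hadj : (G.deleteEdges {s(x, y)}).Adj a b := by
        rw [deleteEdges_adj]; exact ⟨h, he⟩
      rcases ih hz with ⟨z', hz', w', hw'⟩ | ⟨w', hw'⟩
      · exact Or.inl ⟨z', hz', Walk.cons hadj w', by simpa using hw'⟩
      · exact Or.inr ⟨Walk.cons hadj w', by simpa using hw'⟩

lemma exists_ear {G : SimpleGraph V} {D : Set V} {g : ℕ} {x y : V} (hx : x ∈ D) (hy : y ∉ D)
    (hadj : G.Adj x y)
    (hcyc : ∃ w : (G.deleteEdges {s(x, y)}).Walk y x, w.length + 1 ≤ g) :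
    ∃ p X, EarData G D g p X ∧ X 1 = y := by
  classical
  have hex : ∃ n, ∃ z ∈ D, ∃ w : (G.deleteEdges {s(x, y)}).Walk y z, w.length = n := by
    obtain ⟨w, _⟩ := hcyc
    exact ⟨_, x, hx, w, rfl⟩
  obtain ⟨z, hz, w, hw⟩ := Nat.find_spec hex
  have hmin : ∀ z ∈ D, ∀ w' : (G.deleteEdges {s(x, y)}).Walk y z, w.length ≤ w'.length := by
    intro z hz w'
    rw [hw]
    exact Nat.find_min' hex ⟨z, hz, w', rfl⟩
  clear hw hex
  have hle : G.deleteEdges {s(x, y)} ≤ G := deleteEdges_le _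
  let X : ℕ → V := fun i => if i = 0 then x else w.getVert (i - 1)
  have hX0 : X 0 = x := rfl
  have hXs : ∀ i, X (i + 1) = w.getVert i := fun i => rfl
  have hinj : ∀ i i', i < i' → i' ≤ w.length → w.getVert i ≠ w.getVert i' := by
    intro i i' hii hi' heq
    have := hmin z hz ((w.take i).append ((w.drop i').copy heq.symm rfl))
    simp at this
    omega
  have hadj' : ∀ i, i < w.length →
      (G.deleteEdges {s(x, y)}).Adj (w.getVert i) (w.getVert (i + 1)) :=
    fun i hi => w.adj_getVert_succ hi
  refine ⟨w.length + 1, X, ⟨?_, by omega, hx, ?_, ?_, ?_, ?_, ?_⟩, ?_⟩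
  · obtain ⟨w', hw'⟩ := hcyc
    have := hmin x hx w'
    omega
  · rw [hXs, Walk.getVert_length]; exact hz
  · intro i hi
    rcases i with _ | i
    · rw [hX0, hXs, Walk.getVert_zero]; exact hadj
    · rw [hXs, hXs]
      exact hle (hadj' i (by omega))
  · have hne : ∀ i, i < w.length → s(w.getVert i, w.getVert (i + 1)) ≠ s(x, y) := by
      intro i hi
      have := hadj' i hi
      rw [deleteEdges_adj] at this
      exact this.2
    have hinj' : ∀ i i', i ≤ w.length → i' ≤ w.length → w.getVert i = w.getVert i' → i = i' := by
      intro i i' hi hi' h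
      rcases lt_trichotomy i i' with h' | h' | h'
      · exact absurd h (hinj _ _ h' hi')
      · exact h'
      · exact absurd h.symm (hinj _ _ h' hi)
    intro i hi i' hi' h
    rcases i with _ | i <;> rcases i' with _ | i'
    · rfl
    · rw [hX0, hXs, hXs, hXs, Walk.getVert_zero] at h
      exact absurd h.symm (hne i' (by omega))
    · rw [hX0, hXs, hXs, hXs, Walk.getVert_zero] at h
      exact absurd h (hne i (by omega))
    · rw [hXs, hXs, hXs, hXs] at h
      rcases Sym2.eq_iff.1 h with ⟨h1, _⟩ | ⟨h1, h2⟩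
      · rw [hinj' _ _ (by omega) (by omega) h1]
      · have := hinj' _ _ (by omega) (by omega) h1
        have := hinj' _ _ (by omega) (by omega) h2
        omega
  · intro i hi1 hi
    obtain ⟨i, rfl⟩ : ∃ i', i = i' + 1 := ⟨i - 1, by omega⟩
    rw [hXs]
    intro z' hz' w'
    rcases avoid_edge (y := y) hx w' hz' with ⟨z'', hz'', w'', hw''⟩ | ⟨w'', hw''⟩
    · have := hmin z'' hz'' ((w.take i).append w'')
      simp at this
      omega
    · have := hmin z hz (w''.reverse.append (w.drop i))
      simp at this
      omega
  · intro i hi1 hi n hn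
    obtain ⟨i, rfl⟩ : ∃ i', i = i' + 1 := ⟨i - 1, by omega⟩
    rw [hXs] at hn
    have := hn z hz ((w.drop i).mapLe hle)
    simp at this
    omega
  · rw [hXs 0, Walk.getVert_zero]

/-- Rainbow connectedness inside `D` with `n` colors. -/
def RainbowIn (G : SimpleGraph V) (D : Set V) (n : ℕ) (c : Sym2 V → ℕ) : Prop :=
  ∀ x ∈ D, ∀ y ∈ D, ∃ w : G.Walk x y,
    (∀ e ∈ w.edges, EdgeIn D e ∧ c e < n) ∧ (w.edges.map c).Nodup

lemma rainbow_step [Finite V] {G : SimpleGraph V} {g n : ℕ} {D : Set V} {c : Sym2 V → ℕ}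
    (hcyc : ∀ x y, G.Adj x y → ∃ w : (G.deleteEdges {s(x, y)}).Walk y x, w.length + 1 ≤ g)
    (hc : RainbowIn G D n c) :
    ∃ S c', D ⊆ S ∧ (∀ x ∈ D, ∀ y, G.Adj x y → y ∈ S) ∧ RainbowIn G S (n + g) c' := by
  classical
  have h0 : D ∈ {S | ∃ f, EarState G D g S f} := by
    refine ⟨fun _ => 0, subset_rfl, fun v hv => ⟨0, by omega, Or.inl ?_, ?_, ?_⟩⟩
    · intro z _ w; omega
    · exact GoodTo.nil hv
    · exact GoodTo.nil hv
  obtain ⟨S, hDS, ⟨f, hf⟩, hmax⟩ :=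
    (Set.toFinite {S | ∃ f, EarState G D g S f}).exists_le_maximal h0
  refine ⟨S, fun e => if EdgeIn D e then c e else n + f e, hDS, ?_, ?_⟩
  · intro x hx y hxy
    by_contra hy
    obtain ⟨p, X, hX, rfl⟩ := exists_ear hx (fun h => hy (hDS h)) hxy (hcyc x y hxy)
    obtain ⟨S', f', hst, hsub, hmem⟩ := extend hf hX hy
    exact hy (hmax ⟨f', hst⟩ hsub hmem)
  · have key : ∀ x ∈ S, ∀ y ∈ S, ∀ k l, k ≤ l → k ≤ g →
        GoodTo G D S f (fun t => t < k) x → GoodTo G D S f (fun t => l ≤ t ∧ t < g) y →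
        ∃ w : G.Walk x y,
          (∀ e ∈ w.edges, EdgeIn S e ∧ (if EdgeIn D e then c e else n + f e) < n + g) ∧
          (w.edges.map (fun e => if EdgeIn D e then c e else n + f e)).Nodup := by
      rintro x hx y hy k l hkl hkg ⟨z, hz, w, hw, hwn⟩ ⟨z', hz', w', hw', hwn'⟩
      obtain ⟨m, hm, hmn⟩ := hc z hz z' hz'
      refine ⟨w.append (m.append w'.reverse), ?_, ?_⟩
      · intro e he
        simp only [Walk.edges_append, Walk.edges_reverse, List.mem_append, List.mem_reverse] at he
        rcases he with he | he | he
        · obtain ⟨h1, h2, h3⟩ := hw e he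
          rw [if_neg h2]
          exact ⟨h1, by omega⟩
        · obtain ⟨h1, h2⟩ := hm e he
          rw [if_pos h1]
          exact ⟨fun a ha => hDS (h1 a ha), by omega⟩
        · obtain ⟨h1, h2, h3⟩ := hw' e he
          rw [if_neg h2]
          exact ⟨h1, by omega⟩
      · have e1 : w.edges.map (fun e => if EdgeIn D e then c e else n + f e)
            = (w.edges.map f).map (fun t => n + t) := by
          rw [List.map_map]
          exact List.map_congr_left (fun e he => by simp [(hw e he).2.1])
        have e2 : w'.edges.map (fun e => if EdgeIn D e then c e else n + f e)
            = (w'.edges.map f).map (fun t => n + t) := by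
          rw [List.map_map]
          exact List.map_congr_left (fun e he => by simp [(hw' e he).2.1])
        have e3 : m.edges.map (fun e => if EdgeIn D e then c e else n + f e)
            = m.edges.map c :=
          List.map_congr_left (fun e he => by simp [(hm e he).1])
        rw [Walk.edges_append, Walk.edges_append, Walk.edges_reverse, List.map_append,
          List.map_append, List.map_reverse, e1, e2, e3]
        have hi : Function.Injective (fun t => n + t) := fun a b h => by simpa using h
        rw [List.nodup_append', List.nodup_append']
        refine ⟨hwn.map hi, ⟨hmn, List.nodup_reverse.2 (hwn'.map hi), ?_⟩, ?_⟩
        · intro a ha hb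
          simp only [List.mem_reverse, List.mem_map] at ha hb
          obtain ⟨e, he, rfl⟩ := ha
          obtain ⟨_, ⟨e', he', rfl⟩, h⟩ := hb
          have := (hm e he).2
          omega
        · intro a ha hb
          simp only [List.mem_append, List.mem_reverse, List.mem_map] at ha hb
          obtain ⟨_, ⟨e, he, rfl⟩, rfl⟩ := ha
          have h1 := (hw e he).2.2
          rcases hb with ⟨e', he', h⟩ | ⟨_, ⟨e', he', rfl⟩, h⟩
          · have := (hm e' he').2
            omega
          · have := (hw' e' he').2.2
            omega
    intro x hx y hy
    obtain ⟨k, hk, _, hxl, hxr⟩ := hf.2 x hx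
    obtain ⟨l, hl, _, hyl, hyr⟩ := hf.2 y hy
    rcases le_total k l with h | h
    · exact key x hx y hy k l h hk hxl hyr
    · obtain ⟨w, hw, hwn⟩ := key y hy x hx l k h hl hyl hxr
      refine ⟨w.reverse, ?_, ?_⟩
      · intro e he
        exact hw e (by simpa using he)
      · rw [Walk.edges_reverse, List.map_reverse]
        exact List.nodup_reverse.2 hwn

lemma short_cycles {G : SimpleGraph V} (hbl : Bridgeless G)
    (hedge : G.edgeSet.Nonempty) (hET : EdgeTransitive G) :
    3 ≤ G.girth ∧ ∀ x y, G.Adj x y →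
      ∃ w : (G.deleteEdges {s(x, y)}).Walk y x, w.length + 1 ≤ G.girth := by
  have hna : ¬ G.IsAcyclic := by
    intro h
    obtain ⟨e, he⟩ := hedge
    exact hbl e he (isAcyclic_iff_forall_edge_isBridge.1 h he)
  obtain ⟨a, c, hc, hlen⟩ := exists_girth_eq_length.2 hna
  refine ⟨hlen ▸ hc.three_le_length, ?_⟩
  intro x y hxy
  rw [hlen]
  cases c with
  | nil => exact absurd hc (by simp)
  | @cons _ b _ h p =>
    rw [Walk.cons_isCycle_iff] at hc
    obtain ⟨φ, hφ⟩ := hET s(a, b) h s(x, y) hxy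
    have hp : ∀ e ∈ (p.map φ.toHom).edges, e ∉ ({s(x, y)} : Set (Sym2 V)) := by
      intro e he hee
      rw [Set.mem_singleton_iff] at hee
      subst hee
      rw [Walk.edges_map, List.mem_map] at he
      obtain ⟨e', he', hee'⟩ := he
      have : e' = s(a, b) := by
        apply Sym2.map.injective φ.injective
        rw [hφ]; exact hee'
      exact hc.2 (this ▸ he')
    have q := (p.map φ.toHom).toDeleteEdges _ hp
    obtain ⟨q, hq⟩ : ∃ q : (G.deleteEdges {s(x, y)}).Walk (φ b) (φ a), q.length = p.length :=
      ⟨(p.map φ.toHom).toDeleteEdges _ hp, by simp⟩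
    rw [Sym2.map_mk] at hφ
    rcases Sym2.eq_iff.1 hφ with ⟨h1, h2⟩ | ⟨h1, h2⟩
    · exact ⟨q.copy h2 h1, by simp [hq]⟩
    · exact ⟨q.reverse.copy h1 h2, by simp [hq]⟩

/-- A connected bridgeless edge-transitive graph with an edge, girth `g`
and radius at most `r` admits a rainbow coloring with `r * g` colors, i.e. `rc(G) ≤ r·g`. -/
theorem rc_edge_transitive [Fintype V] (G : SimpleGraph V)
    (hconn : G.Connected) (hbl : Bridgeless G)
    (hedge : G.edgeSet.Nonempty) (hET : EdgeTransitive G)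
    (g : ℕ) (hg : G.girth = g)
    (r : ℕ) (hr : 1 ≤ r) (u : V) (hu : ∀ v : V, G.dist u v ≤ r) :
    RcLE G (r * g) := by
  classical
  obtain ⟨hg3, hcyc⟩ := short_cycles hbl hedge hET
  rw [hg] at hg3 hcyc
  have main : ∀ i, ∃ D c, (∀ v, G.dist u v ≤ i → v ∈ D) ∧ RainbowIn G D (i * g) c := by
    intro i
    induction i with
    | zero =>
      refine ⟨{u}, fun _ => 0, ?_, ?_⟩
      · intro v hv
        have : G.dist u v = 0 := by omega
        exact (hconn.dist_eq_zero_iff.1 this).symm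
      · rintro x rfl y rfl
        exact ⟨Walk.nil, by simp, by simp⟩
    | succ i ih =>
      obtain ⟨D, c, hD, hc⟩ := ih
      obtain ⟨S, c', hDS, hN, hc'⟩ := rainbow_step hcyc hc
      refine ⟨S, c', ?_, by rw [Nat.succ_mul]; exact hc'⟩
      intro v hv
      obtain ⟨w, hw⟩ := hconn.exists_walk_length_eq_dist v u
      rw [dist_comm] at hw
      cases w with
      | nil => exact hDS (hD _ (by simp))
      | @cons _ b _ h p =>
        refine hN b (hD b ?_) v h.symm
        have h1 := dist_le p
        rw [dist_comm] at h1
        simp at hw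
        omega
  obtain ⟨D, c, hD, hc⟩ := main r
  have hpos : 0 < r * g := Nat.mul_pos hr (by omega)
  refine ⟨fun e => ⟨c e % (r * g), Nat.mod_lt _ hpos⟩, ?_⟩
  intro x y _
  obtain ⟨w, hw, hwn⟩ := hc x (hD x (hu x)) y (hD y (hu y))
  refine ⟨w.bypass, w.bypass_isPath, ?_⟩
  refine List.Nodup.map_on ?_ w.bypass_isPath.isTrail.edges_nodup
  intro e he e' he' hee
  have he1 := w.edges_bypass_subset_edges he
  have he1' := w.edges_bypass_subset_edges he'
  refine List.inj_on_of_nodup_map hwn he1 he1' ?_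
  have := congrArg Fin.val hee
  simpa [Nat.mod_eq_of_lt (hw e he1).2, Nat.mod_eq_of_lt (hw e' he1').2] using this
end
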